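/- Let s be a nonzero truncated moment sequence in n variables of degree d ≥ 2 and suppose 𝔭_s(c) is a moment sequence for some c ∈ ℝ. Then 𝔭_s(c + t) is a moment sequence for every t > 0; i.e., the set 𝔍_s = {t ∈ ℝ : 𝔭_s(t) is a moment sequence} is closed under adding positive reals. -/

import Mathlib

open Finset MeasureTheory

/-- The heat moment polynomials (explicit solution of the heat moment recursion). -/
noncomputable def fp {n : ℕ} (s : (Fin n → ℕ) → ℝ) (t : ℝ) (α : Fin n → ℕ) : ℝ :=
  ∑ β : (∀ i : Fin n, Fin (α i / 2 + 1)),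
    (∏ i, ((α i).factorial : ℝ) /
        (((α i - 2 * (β i : ℕ)).factorial : ℝ) * (((β i : ℕ)).factorial : ℝ))) *
      s (fun i => α i - 2 * (β i : ℕ)) * t ^ (∑ i, (β i : ℕ))

/-- `s` is a truncated moment sequence of degree `d`. -/
def IsMomentSeq (n d : ℕ) (s : (Fin n → ℕ) → ℝ) : Prop :=
  ∃ μ : Measure (Fin n → ℝ),
    ∀ α : Fin n → ℕ, (∑ i, α i) ≤ d →
      Integrable (fun x : Fin n → ℝ => ∏ i, x i ^ α i) μ ∧
      s α = ∫ x : Fin n → ℝ, ∏ i, x i ^ α i ∂μ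

open ProbabilityTheory in
lemma gm_rec (v : NNReal) (n : ℕ) :
    (∫ z, z ^ (n + 2) ∂(gaussianReal 0 v)) = v * ((n + 1) * ∫ z, z ^ n ∂(gaussianReal 0 v)) := by
  have key : ∀ k, (∫ z, z ^ k ∂(gaussianReal 0 v))
      = iteratedDeriv k (fun u : ℝ => Real.exp (v * u ^ 2 / 2)) 0 := by
    intro k
    have h := iteratedDeriv_mgf_zero (X := id) (μ := gaussianReal 0 v) (by simp) k
    rw [mgf_id_gaussianReal] at h
    simp only [zero_mul, zero_add] at h
    rw [h]
    simp
  have hc : ContDiff ℝ ⊤ (fun u : ℝ => Real.exp (v * u ^ 2 / 2)) := by fun_prop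
  have hd : ∀ k, Differentiable ℝ (iteratedDeriv k (fun u : ℝ => Real.exp (v * u ^ 2 / 2))) :=
    fun k => hc.differentiable_iteratedDeriv k (by exact_mod_cast WithTop.coe_lt_top _)
  have hD : ∀ k u, HasDerivAt (iteratedDeriv k (fun u : ℝ => Real.exp (v * u ^ 2 / 2)))
      (iteratedDeriv (k+1) (fun u : ℝ => Real.exp (v * u ^ 2 / 2)) u) u := by
    intro k u
    rw [iteratedDeriv_succ]
    exact (hd k u).hasDerivAt
  have h1 : iteratedDeriv 1 (fun u : ℝ => Real.exp (v * u ^ 2 / 2)) =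
      fun u => v * (u * iteratedDeriv 0 (fun u : ℝ => Real.exp (v * u ^ 2 / 2)) u) := by
    ext u
    rw [iteratedDeriv_one, iteratedDeriv_zero]
    have : HasDerivAt (fun u : ℝ => Real.exp (v * u ^ 2 / 2))
        (Real.exp (v * u ^ 2 / 2) * (v * (2 * u) / 2)) u := by
      have h := ((hasDerivAt_pow 2 u).const_mul (v : ℝ)).div_const 2
      have := h.exp
      simpa using this
    rw [this.deriv]; ring
  have hrec : ∀ k, iteratedDeriv (k+2) (fun u : ℝ => Real.exp (v * u ^ 2 / 2)) = fun u =>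
      v * (u * iteratedDeriv (k+1) (fun u : ℝ => Real.exp (v * u ^ 2 / 2)) u +
        (k+1) * iteratedDeriv k (fun u : ℝ => Real.exp (v * u ^ 2 / 2)) u) := by
    intro k
    induction k with
    | zero =>
      ext u
      have h := ((hasDerivAt_id u).mul (hD 0 u)).const_mul (v : ℝ)
      rw [iteratedDeriv_succ, zero_add, h1]
      refine h.deriv.trans ?_
      simp only [id, zero_add, Nat.cast_zero]; rw [h1]; ring
    | succ k ih =>
      ext u
      have h := (((hasDerivAt_id u).mul (hD (k+1) u)).add
        ((hD k u).const_mul ((k : ℝ) + 1))).const_mul (v : ℝ)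
      have e : iteratedDeriv (k + 1 + 2) (fun u : ℝ => Real.exp (v * u ^ 2 / 2)) u = _ :=
        (congrFun iteratedDeriv_succ u).trans ((congrArg (fun g => deriv g u) ih).trans h.deriv)
      rw [e]
      simp only [id]; push_cast; ring
  rw [key, key, hrec]; simp

open ProbabilityTheory in
lemma gm_odd (v : NNReal) (k : ℕ) : (∫ z, z ^ (2 * k + 1) ∂(gaussianReal 0 v)) = 0 := by
  induction k with
  | zero => simp
  | succ k ih => rw [show 2 * (k + 1) + 1 = (2 * k + 1) + 2 by ring, gm_rec, ih]; simp

open ProbabilityTheory in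
lemma gm_even (v : NNReal) (t : ℝ) (hv : (v : ℝ) = 2 * t) (k : ℕ) :
    (∫ z, z ^ (2 * k) ∂(gaussianReal 0 v)) = (2 * k).factorial / k.factorial * t ^ k := by
  induction k with
  | zero => simp
  | succ k ih =>
    rw [show 2 * (k + 1) = (2 * k) + 2 by ring, gm_rec, ih, hv, Nat.factorial_succ,
      Nat.factorial_succ, Nat.factorial_succ k]
    have : (k.factorial : ℝ) ≠ 0 := by positivity
    push_cast
    field_simp
    ring

/-- One-variable version of `fp`. -/
noncomputable def fpOne (f : ℕ → ℝ) (t : ℝ) (a : ℕ) : ℝ :=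
  ∑ b : Fin (a / 2 + 1), (a.factorial : ℝ) /
    (((a - 2 * (b : ℕ)).factorial : ℝ) * ((b : ℕ).factorial : ℝ)) * f (a - 2 * (b : ℕ)) * t ^ (b : ℕ)

lemma fpOne_range (f : ℕ → ℝ) (t : ℝ) (a : ℕ) : fpOne f t a =
    ∑ b ∈ range (a / 2 + 1), (a.factorial : ℝ) /
    (((a - 2 * b).factorial : ℝ) * (b.factorial : ℝ)) * f (a - 2 * b) * t ^ b := by
  rw [fpOne, Finset.sum_range]

lemma fpOne_add (f : ℕ → ℝ) (c t : ℝ) (a : ℕ) :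
    fpOne (fpOne f c) t a = fpOne f (c + t) a := by
  simp only [fpOne_range]
  have e1 : ∀ b ∈ range (a / 2 + 1), (a.factorial : ℝ) /
      (((a - 2 * b).factorial : ℝ) * (b.factorial : ℝ)) *
      (∑ bb ∈ range ((a - 2 * b) / 2 + 1), ((a - 2 * b).factorial : ℝ) /
        (((a - 2 * b - 2 * bb).factorial : ℝ) * (bb.factorial : ℝ)) *
        f (a - 2 * b - 2 * bb) * c ^ bb) * t ^ b =
      ∑ bb ∈ range (a / 2 + 1 - b), (a.factorial : ℝ) / ((a - 2 * (b + bb)).factorial : ℝ)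
        * f (a - 2 * (b + bb)) * (t ^ b / b.factorial * (c ^ bb / bb.factorial)) := by
    intro b hb
    rw [Finset.mem_range] at hb
    rw [show (a - 2 * b) / 2 + 1 = a / 2 + 1 - b by omega, Finset.mul_sum, Finset.sum_mul]
    refine Finset.sum_congr rfl fun bb _ => ?_
    rw [show a - 2 * b - 2 * bb = a - 2 * (b + bb) by omega]
    have : ((a - 2 * b).factorial : ℝ) ≠ 0 := by positivity
    field_simp
  rw [Finset.sum_congr rfl e1, ← Finset.sum_range_diag_flip (a / 2 + 1)
    (fun b bb => (a.factorial : ℝ) / ((a - 2 * (b + bb)).factorial : ℝ)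
        * f (a - 2 * (b + bb)) * (t ^ b / b.factorial * (c ^ bb / bb.factorial)))]
  refine Finset.sum_congr rfl fun m _ => ?_
  rw [add_comm c t, add_pow, Finset.mul_sum]
  refine Finset.sum_congr rfl fun k hk => ?_
  have hk : k ≤ m := by rw [Finset.mem_range] at hk; omega
  rw [Nat.add_sub_cancel' hk, Nat.cast_choose ℝ hk]
  have : (m.factorial : ℝ) ≠ 0 := by positivity
  field_simp

lemma prod_fpOne {n : ℕ} (f : Fin n → ℕ → ℝ) (t : ℝ) (α : Fin n → ℕ) :
    ∏ i, fpOne (f i) t (α i) = fp (fun β => ∏ i, f i (β i)) t α := by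
  simp only [fpOne, fp]
  rw [Finset.prod_univ_sum, Fintype.piFinset_univ]
  refine Finset.sum_congr rfl fun β _ => ?_
  rw [Finset.prod_mul_distrib, Finset.prod_mul_distrib, Finset.prod_pow_eq_pow_sum]

lemma fp_integral {n d : ℕ} (μ : Measure (Fin n → ℝ)) (f : Fin n → ℕ → (Fin n → ℝ) → ℝ)
    (u : (Fin n → ℕ) → ℝ)
    (h : ∀ α : Fin n → ℕ, (∑ i, α i) ≤ d →
      Integrable (fun x : Fin n → ℝ => ∏ i, f i (α i) x) μ ∧
      u α = ∫ x : Fin n → ℝ, ∏ i, f i (α i) x ∂μ) (t : ℝ) :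
    ∀ α : Fin n → ℕ, (∑ i, α i) ≤ d →
      Integrable (fun x : Fin n → ℝ => ∏ i, fpOne (fun k => f i k x) t (α i)) μ ∧
      fp u t α = ∫ x : Fin n → ℝ, ∏ i, fpOne (fun k => f i k x) t (α i) ∂μ := by
  intro α hα
  have hle : ∀ β : (∀ i : Fin n, Fin (α i / 2 + 1)), ∑ i, (α i - 2 * (β i : ℕ)) ≤ d := fun β =>
    (Finset.sum_le_sum fun i _ => Nat.sub_le _ _).trans hα
  simp only [prod_fpOne, fp]
  constructor
  · exact integrable_finsetSum _ fun β _ => ((h _ (hle β)).1.const_mul _).mul_const _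
  · rw [integral_finsetSum _ fun β _ => ((h _ (hle β)).1.const_mul _).mul_const _]
    refine Finset.sum_congr rfl fun β _ => ?_
    rw [integral_mul_const, integral_const_mul, (h _ (hle β)).2]

open ProbabilityTheory in
lemma gauss_int (v : NNReal) (k : ℕ) : Integrable (fun z : ℝ => z ^ k) (gaussianReal 0 v) := by
  rcases Nat.eq_zero_or_pos k with rfl | hk
  · simp
  · have := (memLp_id_gaussianReal (μ := 0) (v := v) (k : NNReal))
    have h2 := this.integrable_norm_pow (p := k) (by omega)
    refine (integrable_norm_iff (by fun_prop)).1 ?_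
    simpa using h2

open ProbabilityTheory in
lemma gauss_shift (v : NNReal) (t : ℝ) (hv : (v : ℝ) = 2 * t) (x : ℝ) (a : ℕ) :
    (∫ z, (x + z) ^ a ∂(gaussianReal 0 v)) = fpOne (fun k => x ^ k) t a := by
  simp only [fpOne_range, add_comm x, add_pow]
  rw [integral_finsetSum _ fun j _ => ((gauss_int v j).mul_const _).mul_const _]
  simp only [integral_mul_const]
  symm
  refine Finset.sum_of_injOn (fun b => 2 * b) ?_ ?_ ?_ ?_
  · intro a _ b _ h; simpa using h
  · intro b hb
    simp only [Finset.coe_range, Set.mem_Iio] at hb ⊢; omega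
  · intro j hj hjj
    rcases Nat.even_or_odd' j with ⟨b, rfl | rfl⟩
    · exfalso; apply hjj
      simp only [Finset.coe_range, Set.mem_image, Set.mem_Iio, Finset.mem_range] at hj ⊢
      exact ⟨b, by omega, rfl⟩
    · rw [gm_odd]; simp
  · intro b hb
    rw [Finset.mem_range] at hb
    rw [gm_even v t hv, Nat.cast_choose ℝ (show 2 * b ≤ a by omega)]
    have : ((2 * b).factorial : ℝ) ≠ 0 := by positivity
    field_simp

open ProbabilityTheory in
lemma heat_forward (n d : ℕ) (u : (Fin n → ℕ) → ℝ) (hu : IsMomentSeq n d u) (t : ℝ) (ht : 0 < t) :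
    IsMomentSeq n d (fp u t) := by
  obtain ⟨μ, hμ⟩ := hu
  have hfin : IsFiniteMeasure μ := by
    have := (hμ (fun _ => 0) (by simp)).1
    simpa [integrable_const_iff] using this
  let v : NNReal := ⟨2 * t, by positivity⟩
  have hv : (v : ℝ) = 2 * t := rfl
  let γ : Measure (Fin n → ℝ) := Measure.pi fun _ => gaussianReal 0 v
  refine ⟨(μ.prod γ).map (fun p => p.1 + p.2), fun α hα => ?_⟩
  have hm : Measurable (fun p : (Fin n → ℝ) × (Fin n → ℝ) => p.1 + p.2) := by fun_prop
  have hint : Integrable (fun p : (Fin n → ℝ) × (Fin n → ℝ) => ∏ i, (p.1 i + p.2 i) ^ α i)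
      (μ.prod γ) := by
    simp only [add_pow, Finset.sum_range]
    simp only [Finset.prod_univ_sum, Finset.prod_mul_distrib]
    refine integrable_finsetSum _ fun κ _ => Integrable.mul_const ?_ _
    refine Integrable.mul_prod (f := fun x : Fin n → ℝ => ∏ i, x i ^ (κ i : ℕ))
      (g := fun x : Fin n → ℝ => ∏ i, x i ^ (α i - (κ i : ℕ))) (hμ _ ?_).1 ?_
    · exact (Finset.sum_le_sum fun i _ => Nat.lt_succ_iff.1 (κ i).2).trans hα
    · exact Integrable.fintype_prod (f := fun i z => z ^ (α i - (κ i : ℕ)))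
        fun i => gauss_int v _
  have hsm : AEStronglyMeasurable (fun x : Fin n → ℝ => ∏ i, x i ^ α i)
      ((μ.prod γ).map (fun p => p.1 + p.2)) := by
    apply Measurable.aestronglyMeasurable
    fun_prop
  constructor
  · rw [integrable_map_measure hsm hm.aemeasurable]
    exact hint
  · rw [integral_map hm.aemeasurable hsm]
    simp only [Pi.add_apply]
    rw [integral_prod _ hint, (fp_integral μ (fun i k x => x i ^ k) u hμ t α hα).2]
    refine integral_congr_ae (Filter.Eventually.of_forall fun x => ?_)
    simp only
    rw [integral_fintype_prod_eq_prod (fun i z => (x i + z) ^ α i)]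
    exact Finset.prod_congr rfl fun i _ => (gauss_shift v t hv _ _).symm


/-- If `𝔭_s(c)` is a moment sequence, then so is `𝔭_s(c+t)` for all `t > 0`:
the set `𝔍_s = {t : 𝔭_s(t) is a moment sequence}` is closed under adding positive reals. -/
theorem fp_moment_forward (n d : ℕ) (hn : 0 < n) (hd : 2 ≤ d)
    (s : (Fin n → ℕ) → ℝ) (hs : IsMomentSeq n d s)
    (hne : ∃ α : Fin n → ℕ, (∑ i, α i) ≤ d ∧ s α ≠ 0)
    (c : ℝ) (hc : IsMomentSeq n d (fp s c)) :
    ∀ t : ℝ, 0 < t → IsMomentSeq n d (fp s (c + t)) := by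
  intro t ht
  obtain ⟨μ, hμ⟩ := heat_forward n d _ hc t ht
  obtain ⟨ν, hν⟩ := hs
  refine ⟨μ, fun α hα => ⟨(hμ α hα).1, ?_⟩⟩
  rw [← (hμ α hα).2]
  have h1 := fp_integral ν (fun i k x => x i ^ k) s hν c
  have h2 := fp_integral ν (fun i k x => fpOne (fun k => x i ^ k) c k) _ h1 t α hα
  have h3 := fp_integral ν (fun i k x => x i ^ k) s hν (c + t) α hα
  rw [h2.2, h3.2]
  refine integral_congr_ae (Filter.Eventually.of_forall fun x => ?_)
  exact Finset.prod_congr rfl fun i _ => (fpOne_add _ c t (α i)).symm
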